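/- If a real A satisfies K(A↾n) ≤ K(n) + log log n + c for some constant c and all n ≥ 2 (i.e., A is K-trivial up to log log n), then A is infinitely often K-trivial. -/

import Mathlib

/-! Common framework: prefix-free Kolmogorov complexity via a universal
prefix-free oracle machine, Δ⁰₂ functions and orders, Turing and wtt
reducibility, Ω, and the uniform measure on Cantor space. -/

/-- Finite binary strings, `2^{<ω}`. -/
abbrev BinStr := List Bool

/-- Reals, i.e. infinite binary sequences `2^ω`. -/
abbrev Seq2 := ℕ → Bool

/-- The initial segment `A↾n` of a real `A ∈ 2^ω`. -/
def restrict (A : Seq2) (n : ℕ) : BinStr := (List.range n).map A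

/-- A prefix-free oracle machine, presented as a computable enumeration of
axioms `(τ, p, y)`, meaning: on any oracle extending `τ`, the machine halts on
program `p` with output `y`.  Consistency says that for compatible oracle
strings the halting programs form a prefix-free set and outputs are unique. -/
structure PrefixOracleMachine where
  axioms : ℕ → Option (BinStr × BinStr × BinStr)
  axioms_computable : Computable axioms
  consistent : ∀ s t τ₁ p₁ y₁ τ₂ p₂ y₂,
    axioms s = some (τ₁, p₁, y₁) → axioms t = some (τ₂, p₂, y₂) →
    (τ₁ <+: τ₂ ∨ τ₂ <+: τ₁) → p₁ <+: p₂ → p₁ = p₂ ∧ y₁ = y₂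

/-- `M.Computes A p y` : with oracle `A`, machine `M` halts on program `p` with
output `y`. -/
def PrefixOracleMachine.Computes (M : PrefixOracleMachine) (A : Seq2) (p y : BinStr) : Prop :=
  ∃ s τ, M.axioms s = some (τ, p, y) ∧ ∃ n, τ = restrict A n

/-- A universal prefix-free oracle machine: it describes every string (relative
to every oracle), and it simulates every prefix-free oracle machine up to an
additive constant in the length of programs. -/
structure UniversalPrefixMachine extends PrefixOracleMachine where
  total : ∀ (A : Seq2) (y : BinStr), ∃ p, toPrefixOracleMachine.Computes A p y
  universal : ∀ M : PrefixOracleMachine, ∃ c : ℕ, ∀ (A : Seq2) (p y : BinStr),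
    M.Computes A p y →
      ∃ q, toPrefixOracleMachine.Computes A q y ∧ q.length ≤ p.length + c

/-- `K^A(y)` : prefix-free Kolmogorov complexity of `y` relative to oracle `A`. -/
noncomputable def KOr (U : UniversalPrefixMachine) (A : Seq2) (y : BinStr) : ℕ :=
  sInf {n | ∃ p : BinStr, p.length = n ∧ U.toPrefixOracleMachine.Computes A p y}

/-- The all-zeros (recursive) oracle. -/
def zeroSeq : Seq2 := fun _ => false

/-- `K(y)` : (unrelativized) prefix-free Kolmogorov complexity. -/
noncomputable def Kc (U : UniversalPrefixMachine) (y : BinStr) : ℕ := KOr U zeroSeq y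

/-- `K(n)` : the complexity of the string of `n` zeros. -/
noncomputable def KcNat (U : UniversalPrefixMachine) (n : ℕ) : ℕ :=
  Kc U (List.replicate n false)

/-- `A ∈ KT(g)` : `A` is K-trivial up to `g`. -/
def KT (U : UniversalPrefixMachine) (g : ℕ → ℕ) (A : Seq2) : Prop :=
  ∃ c : ℕ, ∀ n : ℕ, Kc U (restrict A n) ≤ KcNat U n + g n + c

/-- `A ∈ LK(f)` : `A` is low for K up to `f`. -/
def LK (U : UniversalPrefixMachine) (f : BinStr → ℕ) (A : Seq2) : Prop :=
  ∃ c : ℕ, ∀ σ : BinStr, Kc U σ ≤ KOr U A σ + f σ + c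

/-- The position of a string in the length-lexicographic ordering of `2^{<ω}`. -/
def strNum (σ : BinStr) : ℕ := σ.foldl (fun n b => 2 * n + (if b then 2 else 1)) 0

/-- A function `ℕ → ℕ` is Δ⁰₂ iff it has a recursive approximation. -/
def Delta02Fun (g : ℕ → ℕ) : Prop :=
  ∃ G : ℕ → ℕ → ℕ, Computable₂ G ∧ ∀ x, ∃ t, ∀ s ≥ t, G s x = g x

/-- A function `2^{<ω} → ℕ` is Δ⁰₂ iff it has a recursive approximation. -/
def Delta02StrFun (f : BinStr → ℕ) : Prop :=
  ∃ F : ℕ → BinStr → ℕ, Computable₂ F ∧ ∀ σ, ∃ t, ∀ s ≥ t, F s σ = f σ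

/-- A real is Δ⁰₂ iff it has a recursive approximation. -/
def Delta02Seq (A : Seq2) : Prop :=
  ∃ F : ℕ → ℕ → Bool, Computable₂ F ∧ ∀ x, ∃ t, ∀ s ≥ t, F s x = A x

/-- An order: an unbounded nondecreasing function `ℕ → ℕ`. -/
def IsOrder (g : ℕ → ℕ) : Prop := Monotone g ∧ ∀ b : ℕ, ∃ m, b < g m

/-- An order on strings: unbounded and nondecreasing with respect to the
length-lexicographic ordering of `2^{<ω}`. -/
def IsStrOrder (f : BinStr → ℕ) : Prop :=
  (∀ σ τ : BinStr, strNum σ ≤ strNum τ → f σ ≤ f τ) ∧ ∀ b : ℕ, ∃ σ, b < f σ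

/-- `A ∈ KT(Δ⁰₂)` : `A` is K-trivial up to every Δ⁰₂ order. -/
def KTDelta (U : UniversalPrefixMachine) (A : Seq2) : Prop :=
  ∀ g : ℕ → ℕ, Delta02Fun g → IsOrder g → KT U g A

/-- `A ∈ LK(Δ⁰₂)` : `A` is low for K up to every Δ⁰₂ order. -/
def LKDelta (U : UniversalPrefixMachine) (A : Seq2) : Prop :=
  ∀ f : BinStr → ℕ, Delta02StrFun f → IsStrOrder f → LK U f A

/-- A Δ⁰₂ function is finite-to-one approximable if it has a recursive
approximation `F` such that for every `n`, for all but finitely many `m`,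
`F s m > n` for all stages `s`. -/
def FinToOneApprox (f : ℕ → ℕ) : Prop :=
  ∃ F : ℕ → ℕ → ℕ, Computable₂ F ∧ (∀ x, ∃ t, ∀ s ≥ t, F s x = f x) ∧
    ∀ n : ℕ, {m : ℕ | ∃ s, F s m ≤ n}.Finite

/-- A Turing functional, presented as a computable enumeration of axioms
`(τ, n, b)`, meaning: on any oracle extending `τ`, the output bit `n` is `b`. -/
structure TuringFunctional where
  axioms : ℕ → Option (BinStr × ℕ × Bool)
  axioms_computable : Computable axioms
  consistent : ∀ s t τ₁ n₁ b₁ τ₂ n₂ b₂,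
    axioms s = some (τ₁, n₁, b₁) → axioms t = some (τ₂, n₂, b₂) →
    (τ₁ <+: τ₂ ∨ τ₂ <+: τ₁) → n₁ = n₂ → b₁ = b₂

/-- `Φ.Computes B A` : `Φ^B = A`. -/
def TuringFunctional.Computes (Φ : TuringFunctional) (B A : Seq2) : Prop :=
  ∀ n : ℕ, ∃ s k, Φ.axioms s = some (restrict B k, n, A n)

/-- Turing reducibility `A ≤_T B`. -/
def TuringLE (A B : Seq2) : Prop := ∃ Φ : TuringFunctional, Φ.Computes B A

/-- Weak truth-table reducibility `A ≤_wtt B` : a Turing reduction whose use is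
bounded by a recursive function. -/
def WttLE (A B : Seq2) : Prop :=
  ∃ (Φ : TuringFunctional) (u : ℕ → ℕ), Computable u ∧
    ∀ n : ℕ, ∃ s k, k ≤ u n ∧ Φ.axioms s = some (restrict B k, n, A n)

/-- The effective join `A ⊕ B`. -/
def join (A B : Seq2) : Seq2 := fun n => if n % 2 = 0 then A (n / 2) else B (n / 2)

/-- `A` is Martin-Löf random: `K(A↾n) ≥ n - c` for all `n`. -/
def MLRandom (U : UniversalPrefixMachine) (A : Seq2) : Prop :=
  ∃ c : ℕ, ∀ n : ℕ, n ≤ Kc U (restrict A n) + c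

/-- `A` is infinitely often K-trivial. -/
def InfOftenKTrivial (U : UniversalPrefixMachine) (A : Seq2) : Prop :=
  ∃ c : ℕ, {n : ℕ | Kc U (restrict A n) ≤ KcNat U n + c}.Infinite

/-- K-reducibility `B ≤_K A`. -/
def KLE (U : UniversalPrefixMachine) (B A : Seq2) : Prop :=
  ∃ c : ℕ, ∀ n : ℕ, Kc U (restrict B n) ≤ Kc U (restrict A n) + c

/-- LK-reducibility `A ≤_LK B`. -/
def LKLE (U : UniversalPrefixMachine) (A B : Seq2) : Prop :=
  ∃ c : ℕ, ∀ σ : BinStr, KOr U B σ ≤ KOr U A σ + c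

/-- `A` is weakly low for K: `K(σ) ≤ K^A(σ) + c` for infinitely many strings σ. -/
def WeaklyLowForK (U : UniversalPrefixMachine) (A : Seq2) : Prop :=
  ∃ c : ℕ, {σ : BinStr | Kc U σ ≤ KOr U A σ + c}.Infinite

/-- Chaitin's Ω : the measure of the domain of the universal machine. -/
noncomputable def Omega (U : UniversalPrefixMachine) : ℝ :=
  ∑' p : {p : BinStr // ∃ y, U.toPrefixOracleMachine.Computes zeroSeq p y},
    ((2 : ℝ) ^ (p : BinStr).length)⁻¹

/-- The `n`-th binary digit of a real number `x`. -/
noncomputable def realBit (x : ℝ) (n : ℕ) : Bool :=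
  decide (⌊x * 2 ^ (n + 1)⌋ % 2 = 1)

/-- `Ω↾n` : the length-`n` initial segment of the binary expansion of Ω. -/
noncomputable def omegaStr (U : UniversalPrefixMachine) (n : ℕ) : BinStr :=
  (List.range n).map (realBit (Omega U))

/-- `A` is low for Ω. -/
def LowForOmega (U : UniversalPrefixMachine) (A : Seq2) : Prop :=
  ∀ c : ℕ, ∃ n : ℕ, KOr U A (omegaStr U n) + c < n

/-- The uniform (coin-flipping) measure on `2^ω`, obtained as the image of
Lebesgue measure on `[0,1]` under the binary-expansion map. -/
noncomputable def cantorMeasure : MeasureTheory.Measure Seq2 :=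
  MeasureTheory.Measure.map (fun x : ℝ => fun n : ℕ => realBit x n)
    (MeasureTheory.volume.restrict (Set.Icc (0 : ℝ) 1))

theorem strNum_concat (p : BinStr) (b : Bool) :
    strNum (p ++ [b]) = 2 * strNum p + (if b then 2 else 1) := by
  simp [strNum, List.foldl_append]

theorem strNum_injective : Function.Injective strNum := by
  intro p
  induction p using List.reverseRecOn with
  | nil =>
    intro q h
    rcases List.eq_nil_or_concat q with rfl | ⟨q, b, rfl⟩
    · rfl
    · rw [List.concat_eq_append, strNum_concat] at h
      cases b <;> simp [strNum] at h
  | append_singleton p a ih =>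
    intro q h
    rcases List.eq_nil_or_concat q with rfl | ⟨q, b, rfl⟩
    · rw [strNum_concat] at h
      cases a <;> simp [strNum] at h
    · rw [List.concat_eq_append, strNum_concat, strNum_concat] at h
      have key : strNum p = strNum q ∧ a = b := by
        cases a <;> cases b <;> simp at h ⊢ <;> omega
      rw [ih key.1, key.2, List.concat_eq_append]

theorem strNum_lt (p : BinStr) : strNum p + 1 < 2 ^ (p.length + 1) := by
  induction p using List.reverseRecOn with
  | nil => simp [strNum]
  | append_singleton p a ih =>
    rw [strNum_concat, List.length_append, List.length_singleton, pow_succ]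
    cases a <;> simp <;> omega

theorem strNum_primrec : Primrec strNum := by
  have hbit : Primrec fun b : Bool => if b then 2 else 1 :=
    Primrec.dom_finite _
  refine Primrec.list_foldl (h := fun (_ : BinStr) (x : ℕ × Bool) => 2 * x.1 + (if x.2 then 2 else 1))
    Primrec.id (Primrec.const 0) ?_
  exact (Primrec.nat_add.comp
    (Primrec.nat_mul.comp (Primrec.const 2) (Primrec.fst.comp Primrec.snd))
    (hbit.comp (Primrec.snd.comp Primrec.snd))).to₂

theorem length_restrict (A : Seq2) (n : ℕ) : (restrict A n).length = n := by
  simp [restrict]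

theorem take_restrict (A : Seq2) {m n : ℕ} (h : m ≤ n) :
    (restrict A n).take m = restrict A m := by
  simp [restrict, ← List.map_take, List.take_range, h]

theorem restrict_zeroSeq (n : ℕ) : restrict zeroSeq n = List.replicate n false := by
  simp only [restrict]
  exact (List.map_const' ..).trans (by simp)

theorem restrict_prefix_total (A : Seq2) (m n : ℕ) :
    restrict A m <+: restrict A n ∨ restrict A n <+: restrict A m := by
  rcases le_total m n with h | h
  · exact .inl (take_restrict A h ▸ List.take_prefix _ _)
  · exact .inr (take_restrict A h ▸ List.take_prefix _ _)

theorem PrefixOracleMachine.Computes.eq_of_prefix {M : PrefixOracleMachine} {A : Seq2}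
    {p q y z : BinStr} (hp : M.Computes A p y) (hq : M.Computes A q z) (hpq : p <+: q) :
    p = q ∧ y = z := by
  obtain ⟨s, _, hs, m, rfl⟩ := hp
  obtain ⟨t, _, ht, n, rfl⟩ := hq
  exact M.consistent _ _ _ _ _ _ _ _ hs ht (restrict_prefix_total A m n) hpq

/-- Every string has a program of length its complexity. -/
theorem exists_program_length_eq_Kc (U : UniversalPrefixMachine) (y : BinStr) :
    ∃ p : BinStr, p.length = Kc U y ∧ U.toPrefixOracleMachine.Computes zeroSeq p y := by
  obtain ⟨p, hp⟩ := U.total zeroSeq y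
  exact Nat.sInf_mem (s := {n | ∃ p : BinStr, p.length = n ∧
    U.toPrefixOracleMachine.Computes zeroSeq p y}) ⟨p.length, p, rfl, hp⟩

theorem Kc_le_length {U : UniversalPrefixMachine} {p y : BinStr}
    (h : U.toPrefixOracleMachine.Computes zeroSeq p y) : Kc U y ≤ p.length :=
  Nat.sInf_le ⟨p, rfl, h⟩

/-- Invariance: outputs of `M` are at most a constant more complex for `U`. -/
theorem exists_Kc_le_length_add (U : UniversalPrefixMachine) (M : PrefixOracleMachine) :
    ∃ c : ℕ, ∀ p y : BinStr, M.Computes zeroSeq p y → Kc U y ≤ p.length + c := by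
  obtain ⟨c, hc⟩ := U.universal M
  refine ⟨c, fun p y h => ?_⟩
  obtain ⟨q, hq, hl⟩ := hc zeroSeq p y h
  exact (Kc_le_length hq).trans hl

theorem replicate_true_concat_prefix {k l : ℕ}
    (h : List.replicate k true ++ [false] <+: List.replicate l true ++ [false]) : k = l := by
  induction k generalizing l with
  | zero => cases l with
    | zero => rfl
    | succ l => simp [List.replicate_succ] at h
  | succ k ih => cases l with
    | zero => simp [List.replicate_succ] at h
    | succ l =>
      simp only [List.replicate_succ, List.cons_append, List.cons_prefix_cons, true_and] at h
      rw [ih h]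

theorem Primrec.replicate {α : Type*} [Primcodable α] (a : α) :
    Primrec fun n : ℕ => List.replicate n a := by
  refine (Primrec.list_map (f := List.range) (g := fun _ _ => a)
    Primrec.list_range (Primrec.const a).to₂).of_eq fun n => ?_
  simp [List.map_const']

theorem Primrec.two_pow : Primrec fun n : ℕ => 2 ^ n := by
  refine (Primrec.nat_rec₁ (f := fun _ x => 2 * x) 1
    (Primrec.nat_mul.comp (Primrec.const 2) Primrec.snd).to₂).of_eq fun n => ?_
  induction n with
  | zero => rfl
  | succ n ih => simp only [ih, pow_succ]; ring

/-- The machine mapping the program `1ᵏ0` to the string of `2 ^ 2 ^ k` zeros. -/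
def unaryMachine : PrefixOracleMachine where
  axioms k := some ([], List.replicate k true ++ [false], List.replicate (2 ^ 2 ^ k) false)
  axioms_computable := by
    refine Primrec.to_comp (Primrec.option_some.comp (Primrec.pair (Primrec.const []) ?_))
    exact Primrec.pair
      (Primrec.list_append.comp (Primrec.replicate true) (Primrec.const [false]))
      ((Primrec.replicate false).comp (Primrec.two_pow.comp Primrec.two_pow))
  consistent := by
    intro s t τ₁ p₁ y₁ τ₂ p₂ y₂ h₁ h₂ _ hp
    simp only [Option.some.injEq, Prod.mk.injEq] at h₁ h₂
    obtain ⟨-, rfl, rfl⟩ := h₁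
    obtain ⟨-, rfl, rfl⟩ := h₂
    obtain rfl := replicate_true_concat_prefix hp
    exact ⟨rfl, rfl⟩

theorem exists_KcNat_two_pow_two_pow_le (U : UniversalPrefixMachine) :
    ∃ c : ℕ, ∀ k : ℕ, KcNat U (2 ^ 2 ^ k) ≤ k + c := by
  obtain ⟨c, hc⟩ := exists_Kc_le_length_add U unaryMachine
  refine ⟨c + 1, fun k => ?_⟩
  have := hc _ _ ⟨k, [], rfl, 0, rfl⟩
  simp only [List.length_append, List.length_replicate, List.length_singleton] at this
  unfold KcNat
  omega

/-- Combine an axiom `(τ, q, y)` giving a length with an axiom `(σ, p, z)` whose program `p`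
is coded by that length. -/
def truncateAxioms (a b : BinStr × BinStr × BinStr) : Option (BinStr × BinStr × BinStr) :=
  if a.1 = List.replicate a.1.length false ∧ b.1 = List.replicate b.1.length false ∧
      a.2.2.length = strNum b.2.1 then
    some ([], a.2.1, b.2.2.take (strNum b.2.1))
  else none

theorem truncateAxioms_primrec : Primrec₂ truncateAxioms := by
  have hz : PrimrecPred fun l : BinStr => l = List.replicate l.length false :=
    Primrec.eq.comp Primrec.id ((Primrec.replicate false).comp Primrec.list_length)
  have h₁ := Primrec.fst (α := BinStr × BinStr × BinStr) (β := BinStr × BinStr × BinStr)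
  have h₂ := Primrec.snd (α := BinStr × BinStr × BinStr) (β := BinStr × BinStr × BinStr)
  have hn := strNum_primrec.comp (Primrec.fst.comp (Primrec.snd.comp h₂))
  refine Primrec.ite ?_ (Primrec.option_some.comp (Primrec.pair (Primrec.const [])
    (Primrec.pair (Primrec.fst.comp (Primrec.snd.comp h₁)) ?_))) (Primrec.const none)
  · refine (hz.comp (Primrec.fst.comp h₁)).and ((hz.comp (Primrec.fst.comp h₂)).and ?_)
    exact Primrec.eq.comp
      (Primrec.list_length.comp (Primrec.snd.comp (Primrec.snd.comp h₁))) hn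
  · exact Primrec.list_take.comp hn (Primrec.snd.comp (Primrec.snd.comp h₂))

theorem truncateAxioms_eq_some {M : PrefixOracleMachine} {n : ℕ} {τ q x : BinStr}
    (h : ((M.axioms n.unpair.1).bind fun a => (M.axioms n.unpair.2).bind fun b =>
      truncateAxioms a b) = some (τ, q, x)) :
    ∃ y p z, M.Computes zeroSeq q y ∧ M.Computes zeroSeq p z ∧ y.length = strNum p ∧
      x = z.take (strNum p) := by
  simp only [Option.bind_eq_some_iff] at h
  obtain ⟨⟨τ₁, q, y⟩, hs, ⟨τ₂, p, z⟩, ht, h⟩ := h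
  unfold truncateAxioms at h
  split_ifs at h with hc
  simp only [Option.some.injEq, Prod.mk.injEq] at h
  obtain ⟨-, rfl, rfl⟩ := h
  exact ⟨y, p, z, ⟨_, _, hs, _, hc.1.trans (restrict_zeroSeq _).symm⟩,
    ⟨_, _, ht, _, hc.2.1.trans (restrict_zeroSeq _).symm⟩, hc.2.2, rfl⟩

/-- The machine which, on a program `q` on which `M` outputs a string of length `strNum p`, outputs
the first `strNum p` bits of the output of `M` on `p`. -/
def truncateMachine (M : PrefixOracleMachine) : PrefixOracleMachine where
  axioms n := (M.axioms n.unpair.1).bind fun a => (M.axioms n.unpair.2).bind fun b =>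
    truncateAxioms a b
  axioms_computable := by
    have h₁ : Computable fun n : ℕ => M.axioms n.unpair.1 :=
      M.axioms_computable.comp (Computable.fst.comp Computable.unpair)
    have h₂ : Computable fun n : ℕ => M.axioms n.unpair.2 :=
      M.axioms_computable.comp (Computable.snd.comp Computable.unpair)
    have h₃ : Computable₂ truncateAxioms := truncateAxioms_primrec.to_comp
    have h₄ : Computable₂ fun (x : ℕ × BinStr × BinStr × BinStr) (b : BinStr × BinStr × BinStr) =>
        truncateAxioms x.2 b :=
      Computable₂.comp₂ h₃ (Computable.snd.comp Computable.fst).to₂ Computable.snd.to₂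
    have h₅ : Computable fun x : ℕ × BinStr × BinStr × BinStr =>
        (M.axioms x.1.unpair.2).bind fun b => truncateAxioms x.2 b :=
      Computable.option_bind (h₂.comp Computable.fst) h₄
    exact Computable.option_bind h₁ h₅.to₂
  consistent := by
    intro s t τ₁ q₁ x₁ τ₂ q₂ x₂ h₁ h₂ _ hq
    obtain ⟨y₁, p₁, z₁, hq₁, hp₁, hl₁, rfl⟩ := truncateAxioms_eq_some h₁
    obtain ⟨y₂, p₂, z₂, hq₂, hp₂, hl₂, rfl⟩ := truncateAxioms_eq_some h₂
    obtain ⟨rfl, rfl⟩ := hq₁.eq_of_prefix hq₂ hq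
    obtain rfl := strNum_injective (hl₁.symm.trans hl₂)
    obtain ⟨-, rfl⟩ := hp₁.eq_of_prefix hp₂ List.prefix_rfl
    exact ⟨rfl, rfl⟩

theorem truncateMachine_computes {M : PrefixOracleMachine} {p q y z : BinStr}
    (hq : M.Computes zeroSeq q y) (hp : M.Computes zeroSeq p z) (hl : y.length = strNum p) :
    (truncateMachine M).Computes zeroSeq q (z.take (strNum p)) := by
  obtain ⟨s, _, hs, m, rfl⟩ := hq
  obtain ⟨t, _, ht, n, rfl⟩ := hp
  refine ⟨Nat.pair s t, [], ?_, 0, rfl⟩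
  simp [truncateMachine, truncateAxioms, hs, ht, hl, restrict_zeroSeq]

/-- If `p` is a program for `A↾N` and `strNum p ≤ N`, then `A↾(strNum p)` is no more complex than
its length, up to a constant. -/
theorem exists_Kc_restrict_strNum_le (U : UniversalPrefixMachine) :
    ∃ c : ℕ, ∀ (A : Seq2) (p : BinStr) (N : ℕ),
      U.toPrefixOracleMachine.Computes zeroSeq p (restrict A N) → strNum p ≤ N →
        Kc U (restrict A (strNum p)) ≤ KcNat U (strNum p) + c := by
  obtain ⟨c, hc⟩ := exists_Kc_le_length_add U (truncateMachine U.toPrefixOracleMachine)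
  refine ⟨c, fun A p N hp hN => ?_⟩
  obtain ⟨q, hql, hq⟩ := exists_program_length_eq_Kc U (List.replicate (strNum p) false)
  have := hc _ _ (truncateMachine_computes hq hp (List.length_replicate ..))
  rwa [take_restrict A hN, hql] at this

theorem infOftenKTrivial_of_program (U : UniversalPrefixMachine) (A : Seq2) (p : ℕ → BinStr)
    (N : ℕ → ℕ) (hN : Function.Injective N)
    (hp : ∀ k, U.toPrefixOracleMachine.Computes zeroSeq (p k) (restrict A (N k)))
    (hle : ∀ k, strNum (p k) ≤ N k) : InfOftenKTrivial U A := by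
  obtain ⟨c, hc⟩ := exists_Kc_restrict_strNum_le U
  refine ⟨c, Set.infinite_of_injective_forall_mem (f := fun k => strNum (p k)) ?_
    fun k => hc A (p k) (N k) (hp k) (hle k)⟩
  intro k l hkl
  have hpkl : p k = p l := strNum_injective hkl
  have hy := ((hp k).eq_of_prefix (hp l) (hpkl ▸ List.prefix_rfl)).2
  apply hN
  simpa [length_restrict] using congrArg List.length hy

theorem four_mul_le_two_pow {k : ℕ} (hk : 4 ≤ k) : 4 * k ≤ 2 ^ k := by
  induction k, hk using Nat.le_induction with
  | base => norm_num
  | succ k _ ih => rw [pow_succ]; omega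

/-- K-triviality up to log log n implies infinitely often K-triviality. -/
theorem stmt13 (U : UniversalPrefixMachine) (A : Seq2)
    (h : ∃ c : ℕ, ∀ n ≥ 2, Kc U (restrict A n) ≤ KcNat U n + Nat.log 2 (Nat.log 2 n) + c) :
    InfOftenKTrivial U A := by
  obtain ⟨c, hc⟩ := h
  obtain ⟨d, hd⟩ := exists_KcNat_two_pow_two_pow_le U
  choose p hpl hp using fun k =>
    exists_program_length_eq_Kc U (restrict A (2 ^ 2 ^ (k + (c + d + 4))))
  refine infOftenKTrivial_of_program U A p (fun k => 2 ^ 2 ^ (k + (c + d + 4))) ?_ hp fun k => ?_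
  · intro k l hkl
    have := Nat.pow_right_injective le_rfl (Nat.pow_right_injective le_rfl hkl)
    omega
  · set e := k + (c + d + 4) with he
    have h₁ := hc (2 ^ 2 ^ e) (Nat.le_self_pow (by positivity) 2)
    have h₂ := hd e
    have h₃ : 4 * e ≤ 2 ^ e := four_mul_le_two_pow (by omega)
    rw [Nat.log_pow one_lt_two, Nat.log_pow one_lt_two, ← hpl k] at h₁
    have h₄ : 2 ^ ((p k).length + 1) ≤ 2 ^ 2 ^ e := Nat.pow_le_pow_right two_pos (by omega)
    have h₅ := strNum_lt (p k)
    show strNum (p k) ≤ 2 ^ 2 ^ e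
    omega
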